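/- arXiv:2103.00094 — 2 statements merged into one kernel-verified Lean document; each statement's English description precedes it below -/
import Mathlib

section
/- Let T be a tensor category. For every nonzero morphism u : U → 𝟙 in T, the diagram U ⊗ U ⇉ U → 𝟙 (with parallel arrows u ⊗ U and U ⊗ u) is a coequaliser; equivalently, the sequence U ⊗ U →^{u⊗U − U⊗u} U →^{u} 𝟙 → 0 is exact. -/
open CategoryTheory MonoidalCategory CategoryTheory.Limits

universe v u

/-- For any morphism `w : W ⟶ 𝟙` in a monoidal category, the two composites
`W ⊗ W ⟶ W ⟶ 𝟙` (via `w ▷ W` resp. `W ◁ w` followed by the unitors and `w`) agree. -/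
theorem tensor_toUnit_coequalizer_condition {D : Type u} [Category.{v} D]
    [MonoidalCategory D] {W : D} (w : W ⟶ 𝟙_ D) :
    ((w ▷ W) ≫ (λ_ W).hom) ≫ w = ((W ◁ w) ≫ (ρ_ W).hom) ≫ w := by
  rw [Category.assoc, Category.assoc, ← MonoidalCategory.leftUnitor_naturality,
    ← MonoidalCategory.rightUnitor_naturality, ← Category.assoc, ← Category.assoc,
    ← MonoidalCategory.whisker_exchange, MonoidalCategory.unitors_equal]

section Rigid

variable {C : Type u} [Category.{v} C] [MonoidalCategory C]

theorem mono_whiskerRight_of_hasLeftDual {X Y : C} (f : X ⟶ Y) [Mono f] (Z : C)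
    [HasLeftDual Z] : Mono (f ▷ Z) :=
  have := Functor.preservesMonomorphisms_of_adjunction (tensorRightAdjunction (ᘁZ) Z)
  (tensorRight Z).map_mono f

theorem mono_whiskerLeft_of_hasRightDual (Z : C) [HasRightDual Z] {X Y : C} (f : X ⟶ Y)
    [Mono f] : Mono (Z ◁ f) :=
  have := Functor.preservesMonomorphisms_of_adjunction (tensorLeftAdjunction Z (Zᘁ))
  (tensorLeft Z).map_mono f

theorem epi_whiskerLeft_of_hasLeftDual (Z : C) [HasLeftDual Z] {X Y : C} (f : X ⟶ Y)
    [Epi f] : Epi (Z ◁ f) :=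
  have := Functor.preservesEpimorphisms_of_adjunction (tensorLeftAdjunction (ᘁZ) Z)
  (tensorLeft Z).map_epi f

/-- The two ways of contracting `J ⊗ J` to `J` along a monomorphism `J ⟶ 𝟙_ C` agree. -/
theorem whiskerRight_leftUnitor_eq_of_mono {J : C} (i : J ⟶ 𝟙_ C) [Mono i] :
    i ▷ J ≫ (λ_ J).hom = J ◁ i ≫ (ρ_ J).hom :=
  (cancel_mono i).1 (tensor_toUnit_coequalizer_condition i)

theorem coevaluation_comp_whiskerLeft_injective {X Y Z : C} [ExactPairing X Y] {g h : Y ⟶ Z}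
    (w : η_ X Y ≫ X ◁ g = η_ X Y ≫ X ◁ h) : g = h := by
  have := congrArg (tensorLeftHomEquiv _ X Y _).symm w
  simpa only [tensorLeftHomEquiv_symm_coevaluation_comp_whiskerLeft, cancel_epi] using this

/-- The mate `𝟙_ C ⟶ Y` of a monomorphism `X ⟶ 𝟙_ C` is an epimorphism. -/
theorem epi_coevaluation_comp_whiskerRight {X Y : C} [ExactPairing X Y] (i : X ⟶ 𝟙_ C) [Mono i]
    [∀ Z : C, HasLeftDual Z] : Epi (η_ X Y ≫ i ▷ Y ≫ (λ_ Y).hom) := by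
  refine ⟨fun {Z} g h w => coevaluation_comp_whiskerLeft_injective (X := X) ?_⟩
  have := mono_whiskerRight_of_hasLeftDual i Z
  rw [← cancel_mono (i ▷ Z), ← cancel_mono (λ_ Z).hom]
  simpa [whisker_exchange_assoc] using w

theorem mono_coevaluation_whiskerRight (X Y : C) [ExactPairing X Y] : Mono (η_ X Y ▷ X) := by
  have : Mono (η_ X Y ▷ X ≫ (α_ X Y X).hom ≫ X ◁ ε_ X Y) := by
    rw [ExactPairing.evaluation_coevaluation]
    infer_instance
  exact mono_of_mono _ ((α_ X Y X).hom ≫ X ◁ ε_ X Y)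

theorem comp_coevaluation_eq_of_mono {X Y : C} [ExactPairing X Y] (i : X ⟶ 𝟙_ C) [Mono i] :
    i ≫ η_ X Y = (ρ_ X).inv ≫ X ◁ (η_ X Y ≫ i ▷ Y ≫ (λ_ Y).hom) := by
  have h : X ◁ (i ▷ Y ≫ (λ_ Y).hom) = i ▷ (X ⊗ Y) ≫ (λ_ (X ⊗ Y)).hom := by
    have := congrArg (fun f => (α_ X X Y).inv ≫ f ▷ Y) (whiskerRight_leftUnitor_eq_of_mono i)
    simpa using this.symm
  rw [MonoidalCategory.whiskerLeft_comp, h, whisker_exchange_assoc]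
  simp [unitors_equal]

variable [Abelian C] [MonoidalPreadditive C] [RigidCategory C]

/-- A subobject of the unit is idempotent. -/
theorem epi_whiskerLeft_self_of_mono {J : C} (i : J ⟶ 𝟙_ C) [Mono i] : Epi (J ◁ i) := by
  have hz : J ◁ cokernel.π i = 0 := by
    have := mono_whiskerRight_of_hasLeftDual i (cokernel i)
    rw [← cancel_mono (i ▷ cokernel i), ← cancel_mono (λ_ (cokernel i)).hom,
      Category.assoc, whisker_exchange_assoc]
    simp [unitors_equal]
  have : (tensorLeft J).IsLeftAdjoint := (tensorLeftAdjunction (ᘁJ) J).isLeftAdjoint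
  have hS : ((ShortComplex.mk i (cokernel.π i) (cokernel.condition i)).map
      (tensorLeft J)).Exact :=
    (ShortComplex.exact_cokernel i).map_of_epi_of_preservesCokernel (tensorLeft J)
      inferInstance inferInstance
  exact hS.epi_f hz

/-- Every subobject of the unit of an abelian rigid monoidal category is a direct summand. -/
theorem isSplitMono_of_mono_to_tensorUnit {J : C} (i : J ⟶ 𝟙_ C) [Mono i] : IsSplitMono i := by
  let c := η_ J (Jᘁ)
  have h_epi : Epi (i ≫ c) := by
    have := epi_coevaluation_comp_whiskerRight (Y := Jᘁ) i
    have := epi_whiskerLeft_of_hasLeftDual J (η_ J (Jᘁ) ≫ i ▷ (Jᘁ) ≫ (λ_ (Jᘁ)).hom)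
    rw [comp_coevaluation_eq_of_mono]
    infer_instance
  have h_mono : Mono (i ≫ c) := by
    have := mono_whiskerRight_of_hasLeftDual i J
    have : Mono (c ▷ J) := mono_coevaluation_whiskerRight J (Jᘁ)
    have := mono_whiskerLeft_of_hasRightDual (J ⊗ Jᘁ) i
    have := mono_whiskerLeft_of_hasRightDual J i
    have := epi_whiskerLeft_self_of_mono i
    have := isIso_of_mono_of_epi (J ◁ i)
    have h : (i ≫ c) ▷ J ≫ (J ⊗ Jᘁ) ◁ i =
        J ◁ i ≫ (ρ_ J).hom ≫ (i ≫ c) ≫ (ρ_ (J ⊗ Jᘁ)).inv := by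
      rw [← whisker_exchange, rightUnitor_inv_naturality, Iso.hom_inv_id_assoc]
    have hm : Mono (J ◁ i ≫ (ρ_ J).hom ≫ (i ≫ c) ≫ (ρ_ (J ⊗ Jᘁ)).inv) := by
      rw [← h, comp_whiskerRight]
      infer_instance
    have : i ≫ c = ((ρ_ J).inv ≫ inv (J ◁ i)) ≫
        (J ◁ i ≫ (ρ_ J).hom ≫ (i ≫ c) ≫ (ρ_ (J ⊗ Jᘁ)).inv) ≫ (ρ_ (J ⊗ Jᘁ)).hom := by
      simp
    rw [this]
    infer_instance
  have := isIso_of_mono_of_epi (i ≫ c)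
  exact ⟨⟨⟨c ≫ inv (i ≫ c), by rw [← Category.assoc, IsIso.hom_inv_id]⟩⟩⟩

theorem subsingleton_preadditive_of_abelian (A : Type u) [Category.{v} A] [Abelian A] :
    Subsingleton (Preadditive A) :=
  have := Abelian.hasFiniteBiproducts (C := A)
  inferInstance

/-- If every endomorphism of the unit is zero or invertible, a nonzero morphism to the unit is
an epimorphism. -/
theorem epi_of_ne_zero_to_tensorUnit (h_unit : ∀ f : 𝟙_ C ⟶ 𝟙_ C, f ≠ 0 → IsIso f) {U : C}
    (u : U ⟶ 𝟙_ C) (hu : u ≠ 0) : Epi u := by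
  have := isSplitMono_of_mono_to_tensorUnit (image.ι u)
  have h : retraction (image.ι u) ≫ image.ι u ≠ 0 := fun h0 => hu <| by
    have : image.ι u ≫ retraction (image.ι u) ≫ image.ι u = 0 := by rw [h0, comp_zero]
    rw [IsSplitMono.id_assoc] at this
    rw [← image.fac u, this, comp_zero]
  have := h_unit _ h
  have : Epi (image.ι u) := epi_of_epi (retraction (image.ι u)) _
  rw [← image.fac u]
  infer_instance

theorem exact_of_epi_to_tensorUnit {U : C} (u : U ⟶ 𝟙_ C) [Epi u] :
    (ShortComplex.mk ((u ▷ U) ≫ (λ_ U).hom - (U ◁ u) ≫ (ρ_ U).hom) u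
      (by rw [Preadditive.sub_comp, tensor_toUnit_coequalizer_condition, sub_self])).Exact := by
  rw [ShortComplex.exact_iff_exact_up_to_refinements]
  intro A x hx
  have := epi_whiskerLeft_of_hasLeftDual A u
  refine ⟨A ⊗ U, A ◁ u ≫ (ρ_ A).hom, inferInstance, -(x ▷ U), ?_⟩
  have hx' : x ≫ u = 0 := hx
  have h : x ▷ U ≫ u ▷ U = 0 := by
    rw [← comp_whiskerRight, hx', MonoidalPreadditive.zero_whiskerRight]
  simp [Preadditive.comp_sub, reassoc_of% h, ← whisker_exchange_assoc]

end Rigid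

/-- In a tensor category `T` over `k` (abelian, `k`-linear, rigid monoidal, `End 𝟙 = k`),
for every nonzero morphism `u : U ⟶ 𝟙` the diagram `U ⊗ U ⇉ U ⟶ 𝟙` is a coequaliser;
equivalently `u` is an epimorphism and the sequence
`U ⊗ U ⟶[u⊗U - U⊗u] U ⟶[u] 𝟙 ⟶ 0` is exact. -/
theorem nonzero_to_unit_exact
    {k : Type*} [Field k]
    {T : Type u} [Category.{v} T] [Abelian T] [Preadditive T] [Linear k T]
    [MonoidalCategory T] [MonoidalPreadditive T] [MonoidalLinear k T] [RigidCategory T]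
    (hunit : Function.Bijective fun a : k => a • (𝟙 (𝟙_ T)))
    {U : T} (u : U ⟶ 𝟙_ T) (hu : u ≠ 0) :
    Epi u ∧
    (ShortComplex.mk ((u ▷ U) ≫ (λ_ U).hom - (U ◁ u) ≫ (ρ_ U).hom) u
      (by rw [Preadditive.sub_comp, tensor_toUnit_coequalizer_condition, sub_self])).Exact := by
  have hP : ‹Preadditive T› = Abelian.toPreadditive :=
    @Subsingleton.elim _ (subsingleton_preadditive_of_abelian T) _ _
  subst hP
  have h_unit (f : 𝟙_ T ⟶ 𝟙_ T) (hf : f ≠ 0) : IsIso f := by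
    obtain ⟨a, rfl⟩ := hunit.surjective f
    have ha : a ≠ 0 := by
      rintro rfl
      exact hf (zero_smul k _)
    exact ⟨a⁻¹ • 𝟙 _, by simp [smul_smul, ha], by simp [smul_smul, ha]⟩
  have := epi_of_ne_zero_to_tensorUnit h_unit u hu
  exact ⟨this, exact_of_epi_to_tensorUnit u⟩
end

section
/- Let T be a semisimple artinian tensor category over a field k admitting a natural isomorphism g : id ⇒ (−)^{**} which is the identity on endomorphism fields of simple objects. For a simple object X with E_X = End(X) a purely inseparable field extension of k, the map α_X : E_X → k, a ↦ Tr^L(g_X ∘ a), satisfies α_X(a)·α_X(b) = α_X(a∘b)·α_X(id_X) for all a, b ∈ E_X; consequently, since α_X(id_X) ≠ 0, the map a ↦ α_X(a)/α_X(id_X) is a k-algebra homomorphism E_X → k, forcing E_X = k. -/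
open CategoryTheory MonoidalCategory

universe v u

/-- The left categorical trace of `a : X ⟶ X` twisted by an isomorphism `gX : X ≅ Xᘁᘁ`:
the composite `𝟙 ⟶ X ⊗ Xᘁ ⟶ Xᘁᘁ ⊗ Xᘁ ⟶ 𝟙`. -/
noncomputable def twistedTrace {T : Type u} [Category.{v} T] [MonoidalCategory T]
    [RigidCategory T] (X : T) (gX : X ≅ (Xᘁ)ᘁ) (a : X ⟶ X) : 𝟙_ T ⟶ 𝟙_ T :=
  η_ X (Xᘁ) ≫ ((a ≫ gX.hom) ▷ (Xᘁ)) ≫ ε_ (Xᘁ) ((Xᘁ)ᘁ)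

theorem isNilpotent_whiskerRight_sub_whiskerLeft {k : Type*} [Field k] (p : ℕ)
    [Fact p.Prime] [CharP k p] {T : Type u} [Category.{v} T] [Preadditive T] [Linear k T]
    [MonoidalCategory T] [MonoidalPreadditive T] [MonoidalLinear k T] {X : T}
    (b : End X) {m : ℕ} {c : k} (hb : b ^ p ^ m = c • (1 : End X)) :
    IsNilpotent (End.of (b ▷ X) - End.of (X ◁ b) : End (X ⊗ X)) := by
  have hr : ∀ n : ℕ, (End.of (b ▷ X) ^ n : End (X ⊗ X)) = (b ^ n : End X) ▷ X := by
    intro n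
    induction n with
    | zero => simp [End.one_def]
    | succ n ih => rw [pow_succ, pow_succ, ih, End.mul_def, End.mul_def, comp_whiskerRight]
  have hl : ∀ n : ℕ, (End.of (X ◁ b) ^ n : End (X ⊗ X)) = X ◁ (b ^ n : End X) := by
    intro n
    induction n with
    | zero => simp [End.one_def]
    | succ n ih => rw [pow_succ, pow_succ, ih, End.mul_def, End.mul_def, whiskerLeft_comp]
  rcases subsingleton_or_nontrivial (End (X ⊗ X)) with hs | hs
  · exact ⟨1, Subsingleton.elim _ _⟩
  · have : CharP (End (X ⊗ X)) p := charP_of_injective_algebraMap' k p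
    have hcomm : Commute (End.of (b ▷ X)) (End.of (X ◁ b) : End (X ⊗ X)) :=
      whisker_exchange b b
    refine ⟨p ^ m, ?_⟩
    rw [sub_pow_char_pow_of_commute _ _ hcomm, hr, hl, hb]
    have h1 : (c • 𝟙 X) ▷ X = X ◁ (c • 𝟙 X) := by simp
    exact sub_eq_zero.2 h1

section TwistedTrace

open ExactPairing

variable {T : Type u} [Category.{v} T] [MonoidalCategory T] [RigidCategory T]

theorem twistedTrace_comp_comm (g : ∀ Y : T, Y ≅ (Yᘁ)ᘁ)
    (hg : ∀ {X Y : T} (f : X ⟶ Y), f ≫ (g Y).hom = (g X).hom ≫ ((fᘁ)ᘁ))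
    {Y Z : T} (f : Y ⟶ Z) (h : Z ⟶ Y) :
    twistedTrace Y (g Y) (f ≫ h) = twistedTrace Z (g Z) (h ≫ f) := by
  have e : (hᘁ)ᘁ ▷ Yᘁ ≫ ε_ (Yᘁ) ((Yᘁ)ᘁ) = (Zᘁ)ᘁ ◁ hᘁ ≫ ε_ (Zᘁ) ((Zᘁ)ᘁ) :=
    rightAdjointMate_comp_evaluation _
  calc twistedTrace Y (g Y) (f ≫ h)
      = η_ Y (Yᘁ) ≫ (f ≫ (g Z).hom) ▷ Yᘁ ≫ (hᘁ)ᘁ ▷ Yᘁ ≫ ε_ (Yᘁ) ((Yᘁ)ᘁ) := by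
        simp only [twistedTrace, Category.assoc, hg h, comp_whiskerRight]
    _ = (η_ Y (Yᘁ) ≫ Y ◁ hᘁ) ≫ (f ≫ (g Z).hom) ▷ Zᘁ ≫ ε_ (Zᘁ) ((Zᘁ)ᘁ) := by
        rw [e, ← whisker_exchange_assoc, Category.assoc]
    _ = twistedTrace Z (g Z) (h ≫ f) := by
        rw [coevaluation_comp_rightAdjointMate]
        simp [twistedTrace]

theorem exists_twistedTrace_eq {Y D : T} (gY : Y ≅ (Yᘁ)ᘁ) (δ : 𝟙_ T ⟶ Y ⊗ D)
    (φ : Y ⊗ D ⟶ 𝟙_ T) :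
    ∃ θ : Y ⟶ Y, (∀ f : Y ⟶ Y, δ ≫ f ▷ D ≫ φ = twistedTrace Y gY (f ≫ θ)) ∧
      ∀ (c : Y ⟶ Y) (c' : D ⟶ D), c ≫ gY.hom = gY.hom ≫ (cᘁ)ᘁ →
        δ ≫ c ▷ D = δ ≫ Y ◁ c' → c ▷ D ≫ φ = Y ◁ c' ≫ φ → c ≫ θ = θ ≫ c := by
  have coev_inj : ∀ {v₁ v₂ : Yᘁ ⟶ D}, η_ Y (Yᘁ) ≫ Y ◁ v₁ = η_ Y (Yᘁ) ≫ Y ◁ v₂ → v₁ = v₂ := by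
    intro v₁ v₂ h
    have := congrArg (tensorLeftHomEquiv _ Y (Yᘁ) _).symm h
    simpa [tensorLeftHomEquiv_symm_coevaluation_comp_whiskerLeft] using this
  have ev_inj : ∀ {w₁ w₂ : Y ⟶ (Yᘁ)ᘁ},
      w₁ ▷ Yᘁ ≫ ε_ (Yᘁ) ((Yᘁ)ᘁ) = w₂ ▷ Yᘁ ≫ ε_ (Yᘁ) ((Yᘁ)ᘁ) → w₁ = w₂ := by
    intro w₁ w₂ h
    have := congrArg (tensorRightHomEquiv _ (Yᘁ) ((Yᘁ)ᘁ) _) h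
    simpa [tensorRightHomEquiv_whiskerRight_comp_evaluation] using this
  obtain ⟨v, hv⟩ : ∃ v : Yᘁ ⟶ D, η_ Y (Yᘁ) ≫ Y ◁ v = δ := by
    refine ⟨(ρ_ _).inv ≫ (tensorLeftHomEquiv _ Y (Yᘁ) _).symm δ, ?_⟩
    apply (tensorLeftHomEquiv _ Y (Yᘁ) _).symm.injective
    rw [tensorLeftHomEquiv_symm_coevaluation_comp_whiskerLeft]
    simp
  obtain ⟨w, hw⟩ : ∃ w : Y ⟶ (Yᘁ)ᘁ, w ▷ Yᘁ ≫ ε_ (Yᘁ) ((Yᘁ)ᘁ) = Y ◁ v ≫ φ := by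
    refine ⟨tensorRightHomEquiv _ (Yᘁ) ((Yᘁ)ᘁ) _ (Y ◁ v ≫ φ) ≫ (λ_ _).hom, ?_⟩
    apply (tensorRightHomEquiv _ (Yᘁ) ((Yᘁ)ᘁ) _).injective
    rw [tensorRightHomEquiv_whiskerRight_comp_evaluation]
    simp
  refine ⟨w ≫ gY.inv, fun f => ?_, fun c c' hc hδ hφ => ?_⟩
  · rw [← hv, Category.assoc, whisker_exchange_assoc, ← hw]
    simp [twistedTrace]
  · have hvc : cᘁ ≫ v = v ≫ c' := by
      apply coev_inj
      rw [whiskerLeft_comp, coevaluation_comp_rightAdjointMate_assoc, ← whisker_exchange,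
        whiskerLeft_comp, ← Category.assoc, ← Category.assoc, hv, hδ]
    have hwc : c ≫ w = w ≫ (cᘁ)ᘁ := by
      apply ev_inj
      rw [comp_whiskerRight, comp_whiskerRight, Category.assoc, Category.assoc, hw,
        rightAdjointMate_comp_evaluation, ← whisker_exchange_assoc c,
        ← whisker_exchange_assoc w, hw, hφ, ← whiskerLeft_comp_assoc, ← whiskerLeft_comp_assoc, hvc]
    rw [← Category.assoc, hwc, Category.assoc, Category.assoc]
    congr 1
    rw [Iso.eq_inv_comp, ← Category.assoc, ← hc, Category.assoc, Iso.hom_inv_id,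
      Category.comp_id]

/-- The coevaluation of `X ⊗ X` against `Xᘁ ⊗ Xᘁ`, nesting that of `X` inside itself. -/
noncomputable def nestedCoevaluation (X : T) : 𝟙_ T ⟶ (X ⊗ X) ⊗ (Xᘁ ⊗ Xᘁ) :=
  η_ X (Xᘁ) ⊗≫ X ◁ η_ X (Xᘁ) ▷ Xᘁ ⊗≫ 𝟙 ((X ⊗ X) ⊗ (Xᘁ ⊗ Xᘁ))

/-- The pairing of `X ⊗ X` with `Xᘁ ⊗ Xᘁ` that nests a pairing of `X` with `Xᘁ` inside itself. -/
noncomputable def nestedPairing (X : T) (e : X ⊗ Xᘁ ⟶ 𝟙_ T) :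
    (X ⊗ X) ⊗ (Xᘁ ⊗ Xᘁ) ⟶ 𝟙_ T :=
  𝟙 ((X ⊗ X) ⊗ (Xᘁ ⊗ Xᘁ)) ⊗≫ X ◁ e ▷ Xᘁ ⊗≫ e

theorem nestedCoevaluation_fst {X : T} (b : X ⟶ X) :
    nestedCoevaluation X ≫ (b ▷ X) ▷ (Xᘁ ⊗ Xᘁ) =
      nestedCoevaluation X ≫ (X ⊗ X) ◁ (Xᘁ ◁ bᘁ) := by
  calc _ = η_ X (Xᘁ) ⊗≫ ((X ◁ η_ X (Xᘁ) ≫ b ▷ (X ⊗ Xᘁ)) ▷ Xᘁ) ⊗≫ 𝟙 _ := by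
        unfold nestedCoevaluation; monoidal
    _ = (η_ X (Xᘁ) ≫ b ▷ Xᘁ) ⊗≫ X ◁ η_ X (Xᘁ) ▷ Xᘁ ⊗≫ 𝟙 _ := by
        rw [whisker_exchange]; monoidal
    _ = η_ X (Xᘁ) ⊗≫ X ◁ (𝟙_ T ◁ bᘁ ≫ η_ X (Xᘁ) ▷ Xᘁ) ⊗≫ 𝟙 _ := by
        rw [← coevaluation_comp_rightAdjointMate]; monoidal
    _ = _ := by
        rw [whisker_exchange]; unfold nestedCoevaluation; monoidal

theorem nestedCoevaluation_snd {X : T} (b : X ⟶ X) :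
    nestedCoevaluation X ≫ (X ◁ b) ▷ (Xᘁ ⊗ Xᘁ) =
      nestedCoevaluation X ≫ (X ⊗ X) ◁ (bᘁ ▷ Xᘁ) := by
  calc _ = η_ X (Xᘁ) ⊗≫ X ◁ (η_ X (Xᘁ) ≫ b ▷ Xᘁ) ▷ Xᘁ ⊗≫ 𝟙 _ := by
        unfold nestedCoevaluation; monoidal
    _ = _ := by
        rw [← coevaluation_comp_rightAdjointMate]; unfold nestedCoevaluation; monoidal

theorem nestedPairing_fst {X : T} {e : X ⊗ Xᘁ ⟶ 𝟙_ T} {b : X ⟶ X}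
    (he : b ▷ Xᘁ ≫ e = X ◁ bᘁ ≫ e) :
    (b ▷ X) ▷ (Xᘁ ⊗ Xᘁ) ≫ nestedPairing X e =
      (X ⊗ X) ◁ (Xᘁ ◁ bᘁ) ≫ nestedPairing X e := by
  calc _ = 𝟙 _ ⊗≫ ((b ▷ (X ⊗ Xᘁ) ≫ X ◁ e) ▷ Xᘁ) ⊗≫ e := by
        unfold nestedPairing; monoidal
    _ = 𝟙 _ ⊗≫ X ◁ e ▷ Xᘁ ⊗≫ (b ▷ Xᘁ ≫ e) := by
        rw [← whisker_exchange]; monoidal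
    _ = 𝟙 _ ⊗≫ X ◁ (e ▷ Xᘁ ≫ 𝟙_ T ◁ bᘁ) ⊗≫ e := by
        rw [he]; monoidal
    _ = _ := by
        rw [← whisker_exchange]; unfold nestedPairing; monoidal

theorem nestedPairing_snd {X : T} {e : X ⊗ Xᘁ ⟶ 𝟙_ T} {b : X ⟶ X}
    (he : b ▷ Xᘁ ≫ e = X ◁ bᘁ ≫ e) :
    (X ◁ b) ▷ (Xᘁ ⊗ Xᘁ) ≫ nestedPairing X e =
      (X ⊗ X) ◁ (bᘁ ▷ Xᘁ) ≫ nestedPairing X e := by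
  calc _ = 𝟙 _ ⊗≫ X ◁ (b ▷ Xᘁ ≫ e) ▷ Xᘁ ⊗≫ e := by
        unfold nestedPairing; monoidal
    _ = _ := by
        rw [he]; unfold nestedPairing; monoidal

theorem nestedCoevaluation_comp_nestedPairing {X : T} (e : X ⊗ Xᘁ ⟶ 𝟙_ T) (a b : X ⟶ X) :
    nestedCoevaluation X ≫ (a ▷ X ≫ X ◁ b) ▷ (Xᘁ ⊗ Xᘁ) ≫ nestedPairing X e =
      η_ X (Xᘁ) ≫ ((a ▷ Xᘁ ≫ (ρ_ X).inv ▷ Xᘁ) ≫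
        (X ◁ (η_ X (Xᘁ) ≫ b ▷ Xᘁ ≫ e)) ▷ Xᘁ ≫ (ρ_ X).hom ▷ Xᘁ) ≫ e := by
  calc _ = η_ X (Xᘁ) ⊗≫ ((X ◁ η_ X (Xᘁ) ≫ a ▷ (X ⊗ Xᘁ)) ▷ Xᘁ) ⊗≫
        X ◁ (b ▷ Xᘁ ≫ e) ▷ Xᘁ ⊗≫ e := by
        unfold nestedCoevaluation nestedPairing; monoidal
    _ = _ := by
        rw [whisker_exchange]; monoidal

theorem whiskerRight_comp_twistedEvaluation (g : ∀ Y : T, Y ≅ (Yᘁ)ᘁ)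
    (hg : ∀ {X Y : T} (f : X ⟶ Y), f ≫ (g Y).hom = (g X).hom ≫ ((fᘁ)ᘁ)) {X : T} (b : X ⟶ X) :
    b ▷ Xᘁ ≫ (g X).hom ▷ Xᘁ ≫ ε_ (Xᘁ) ((Xᘁ)ᘁ) =
      X ◁ bᘁ ≫ (g X).hom ▷ Xᘁ ≫ ε_ (Xᘁ) ((Xᘁ)ᘁ) := by
  rw [← comp_whiskerRight_assoc, hg, comp_whiskerRight_assoc, rightAdjointMate_comp_evaluation,
    whisker_exchange_assoc]

theorem twistedTrace_eq_zero_of_pow_eq_zero [Abelian T] [MonoidalPreadditive T]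
    (g : ∀ Y : T, Y ≅ (Yᘁ)ᘁ)
    (hg : ∀ {X Y : T} (f : X ⟶ Y), f ≫ (g Y).hom = (g X).hom ≫ ((fᘁ)ᘁ)) (n : ℕ) :
    ∀ {Y : T} (f : End Y), f ^ n = 0 → twistedTrace Y (g Y) f = 0 := by
  induction n with
  | zero =>
    intro Y f hf
    have h1 : 𝟙 Y = 0 := hf
    have h2 : f = (0 : Y ⟶ Y) := by
      rw [← Category.comp_id (X := Y) f, h1, Limits.comp_zero]
    simp [twistedTrace, h2]
  | succ n ih =>
    intro Y f hf
    let q := Limits.factorThruImage (X := Y) (Y := Y) f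
    let i := Limits.image.ι (X := Y) (Y := Y) f
    have hqi : q ≫ i = f := Limits.image.fac _
    have hpow : ∀ m : ℕ, q ≫ (End.of (i ≫ q) ^ m : End _) ≫ i = (f ^ (m + 1) : End Y) := by
      intro m
      induction m with
      | zero => simp [End.one_def, hqi]
      | succ m hm =>
        rw [pow_succ', pow_succ' f, ← hm, End.mul_def, End.mul_def]
        simp [End.of, ← hqi]
    have hzero : (End.of (i ≫ q) ^ n : End _) = 0 := by
      have h := hpow n
      rw [hf] at h
      have h' := Limits.zero_of_epi_comp q h
      exact Limits.zero_of_comp_mono i h'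
    rw [← hqi, twistedTrace_comp_comm g hg]
    exact ih _ hzero

theorem twistedTrace_sub [Abelian T] [MonoidalPreadditive T] (X : T) (gX : X ≅ (Xᘁ)ᘁ)
    (a b : X ⟶ X) :
    twistedTrace X gX (a - b) = twistedTrace X gX a - twistedTrace X gX b := by
  have h : (a ≫ gX.hom - b ≫ gX.hom) ▷ Xᘁ = (a ≫ gX.hom) ▷ Xᘁ - (b ≫ gX.hom) ▷ Xᘁ :=
    (tensorRight (Xᘁ)).map_sub
  simp only [twistedTrace, Preadditive.sub_comp, Preadditive.comp_sub, h]

section Linear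

variable {k : Type*} [Field k] [Abelian T] [Linear k T] [MonoidalPreadditive T]

theorem mono_coevaluation (hunit : Function.Bijective fun a : k => a • (𝟙 (𝟙_ T)))
    (hss : ∀ (X Y : T) (f : X ⟶ Y), Mono f → ∃ r : Y ⟶ X, f ≫ r = 𝟙 X) (X : T) [Simple X] :
    Mono (η_ X (Xᘁ)) := by
  have hη : η_ X (Xᘁ) ≠ 0 := by
    intro h
    have h1 := evaluation_coevaluation X (Xᘁ)
    rw [h] at h1
    have h2 : (λ_ X).hom ≫ (ρ_ X).inv = 0 := by simpa using h1.symm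
    apply id_nonzero X
    calc 𝟙 X = (λ_ X).inv ≫ ((λ_ X).hom ≫ (ρ_ X).inv) ≫ (ρ_ X).hom := by simp
      _ = 0 := by rw [h2]; simp
  obtain ⟨r, hr⟩ := hss _ _ (Limits.kernel.ι (η_ X (Xᘁ))) inferInstance
  obtain ⟨c, hc⟩ := hunit.2 (r ≫ Limits.kernel.ι (η_ X (Xᘁ)))
  simp only at hc
  have hc0 : c • η_ X (Xᘁ) = 0 := by
    rw [← Category.id_comp (η_ X (Xᘁ)), ← Linear.smul_comp, hc, Category.assoc,
      Limits.kernel.condition, Limits.comp_zero]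
  have hc1 : c = 0 := (smul_eq_zero.1 hc0).resolve_right hη
  apply Preadditive.mono_of_kernel_zero
  rw [← Category.id_comp (Limits.kernel.ι (η_ X (Xᘁ))), ← hr, Category.assoc, ← hc, hc1]
  simp

theorem exists_twistedTrace_eq_id (hunit : Function.Bijective fun a : k => a • (𝟙 (𝟙_ T)))
    (hss : ∀ (X Y : T) (f : X ⟶ Y), Mono f → ∃ r : Y ⟶ X, f ≫ r = 𝟙 X) (X : T) [Simple X]
    (gX : X ≅ (Xᘁ)ᘁ) : ∃ a : X ⟶ X, twistedTrace X gX a = 𝟙 (𝟙_ T) := by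
  obtain ⟨r, hr⟩ := hss _ _ _ (mono_coevaluation hunit hss X)
  let w : X ⟶ (Xᘁ)ᘁ := tensorRightHomEquiv _ (Xᘁ) ((Xᘁ)ᘁ) _ r ≫ (λ_ _).hom
  have hw : w ▷ Xᘁ ≫ ε_ (Xᘁ) ((Xᘁ)ᘁ) = r := by
    apply (tensorRightHomEquiv _ (Xᘁ) ((Xᘁ)ᘁ) _).injective
    rw [tensorRightHomEquiv_whiskerRight_comp_evaluation]
    simp [w]
  refine ⟨w ≫ gX.inv, ?_⟩
  simp only [twistedTrace, Category.assoc, Iso.inv_hom_id, Category.comp_id, hw, hr]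

variable [MonoidalLinear k T]

theorem twistedTrace_smul (X : T) (gX : X ≅ (Xᘁ)ᘁ) (r : k) (a : X ⟶ X) :
    twistedTrace X gX (r • a) = r • twistedTrace X gX a := by
  simp [twistedTrace]

theorem twistedTrace_comp_twistedTrace (p : ℕ) [Fact p.Prime] [CharP k p]
    (hunit : Function.Bijective fun a : k => a • (𝟙 (𝟙_ T))) (g : ∀ Y : T, Y ≅ (Yᘁ)ᘁ)
    (hg : ∀ {X Y : T} (f : X ⟶ Y), f ≫ (g Y).hom = (g X).hom ≫ ((fᘁ)ᘁ)) (X : T)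
    (hcomm : ∀ a b : X ⟶ X, a ≫ b = b ≫ a)
    (hinsep : ∀ a : End X, ∃ (m : ℕ) (c : k), a ^ p ^ m = c • (1 : End X)) (a b : X ⟶ X) :
    twistedTrace X (g X) a ≫ twistedTrace X (g X) b =
      twistedTrace X (g X) (b ≫ a) ≫ twistedTrace X (g X) (𝟙 X) := by
  let e : X ⊗ Xᘁ ⟶ 𝟙_ T := (g X).hom ▷ Xᘁ ≫ ε_ (Xᘁ) ((Xᘁ)ᘁ)
  have htr : ∀ b : X ⟶ X, η_ X (Xᘁ) ≫ b ▷ Xᘁ ≫ e = twistedTrace X (g X) b := fun b => by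
    simp [e, twistedTrace]
  obtain ⟨θ, hθ, hθc⟩ := exists_twistedTrace_eq (g (X ⊗ X)) (nestedCoevaluation X)
    (nestedPairing X e)
  have he := fun b : X ⟶ X => whiskerRight_comp_twistedEvaluation g hg b
  have hfst : ∀ b : X ⟶ X, b ▷ X ≫ θ = θ ≫ b ▷ X := fun b =>
    hθc _ _ (hg _) (nestedCoevaluation_fst b) (nestedPairing_fst (he b))
  have hsnd : ∀ b : X ⟶ X, X ◁ b ≫ θ = θ ≫ X ◁ b := fun b =>
    hθc _ _ (hg _) (nestedCoevaluation_snd b) (nestedPairing_snd (he b))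
  have hmul : ∀ a b : X ⟶ X, twistedTrace X (g X) a ≫ twistedTrace X (g X) b =
      twistedTrace (X ⊗ X) (g (X ⊗ X)) ((a ▷ X ≫ X ◁ b) ≫ θ) := by
    intro a b
    rw [← hθ, nestedCoevaluation_comp_nestedPairing, htr]
    obtain ⟨s, hs⟩ := hunit.2 (twistedTrace X (g X) b)
    simp only at hs
    rw [← hs]
    simp [htr]
  obtain ⟨m, c, hb⟩ := hinsep b
  have hd := isNilpotent_whiskerRight_sub_whiskerLeft p (k := k) b hb
  have hcom : Commute (End.of (b ▷ X) - End.of (X ◁ b) : End (X ⊗ X))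
      (End.of θ * End.of (a ▷ X)) := by
    refine Commute.sub_left (Commute.mul_right (hfst b).symm ?_)
      (Commute.mul_right (hsnd b).symm (whisker_exchange a b).symm)
    change a ▷ X ≫ b ▷ X = b ▷ X ≫ a ▷ X
    rw [← comp_whiskerRight, hcomm, comp_whiskerRight]
  obtain ⟨n, hn⟩ := hcom.isNilpotent_mul_right hd
  have h0 := twistedTrace_eq_zero_of_pow_eq_zero g hg n _ hn
  rw [hmul, hmul, eq_comm, ← sub_eq_zero, ← twistedTrace_sub, ← h0]
  congr 1
  rw [hcomm b a]
  simp only [End.mul_def, End.of, Category.assoc, whiskerLeft_id, comp_whiskerRight,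
    Category.comp_id, hfst b, hsnd b]
  rw [← Preadditive.comp_sub, ← Preadditive.comp_sub]

end Linear

end TwistedTrace

/-- Let `T` be a semisimple artinian tensor category over a separably closed field `k` of
characteristic `p > 0`, with a natural isomorphism `g : id ≅ (−)^{∗∗}` (in particular the
identity on the endomorphism fields of simple objects).  Let `X` be simple with
`E_X = End X` a commutative (purely inseparable) field extension of `k`.  Then the map
`α_X : a ↦ Tr^L(g_X ∘ a)` satisfies `α_X(a)·α_X(b) = α_X(a∘b)·α_X(id)`, `α_X(id) ≠ 0`,
and consequently `E_X = k`. -/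
theorem simple_endomorphism_field_trivial
    {k : Type*} [Field k] [IsSepClosed k] (p : ℕ) [Fact p.Prime] [CharP k p]
    {T : Type u} [Category.{v} T] [Abelian T] [Preadditive T] [Linear k T]
    [MonoidalCategory T] [MonoidalPreadditive T] [MonoidalLinear k T] [RigidCategory T]
    [∀ X Y : T, FiniteDimensional k (X ⟶ Y)]
    (hunit : Function.Bijective fun a : k => a • (𝟙 (𝟙_ T)))
    -- semisimplicity: every monomorphism splits
    (hss : ∀ (X Y : T) (f : X ⟶ Y), Mono f → ∃ r : Y ⟶ X, f ≫ r = 𝟙 X)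
    -- the natural isomorphism g : id ≅ (−)^{∗∗}
    (g : ∀ Y : T, Y ≅ (Yᘁ)ᘁ)
    (hg : ∀ {X Y : T} (f : X ⟶ Y), f ≫ (g Y).hom = (g X).hom ≫ ((fᘁ)ᘁ))
    (X : T) [Simple X]
    -- E_X = End X is a commutative division algebra, purely inseparable over k
    (hcomm : ∀ a b : X ⟶ X, a ≫ b = b ≫ a)
    (hinsep : ∀ a : CategoryTheory.End X, ∃ (m : ℕ) (c : k),
      a ^ p ^ m = c • (1 : CategoryTheory.End X)) :
    (∀ a b : X ⟶ X,
      twistedTrace X (g X) a ≫ twistedTrace X (g X) b =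
        twistedTrace X (g X) (b ≫ a) ≫ twistedTrace X (g X) (𝟙 X)) ∧
    twistedTrace X (g X) (𝟙 X) ≠ 0 ∧
    (∀ a : X ⟶ X, ∃ c : k, a = c • 𝟙 X) := by
  have := @subsingleton_preadditive_of_hasBinaryBiproducts T _ Abelian.toPreadditive.preadditiveHasZeroMorphisms
    Abelian.hasBinaryBiproducts
  obtain rfl : ‹Preadditive T› = Abelian.toPreadditive := Subsingleton.elim _ _
  have hmul := twistedTrace_comp_twistedTrace p hunit g hg X hcomm hinsep
  have hne : twistedTrace X (g X) (𝟙 X) ≠ 0 := by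
    intro h
    obtain ⟨a, ha⟩ := exists_twistedTrace_eq_id hunit hss X (g X)
    have h1 : 𝟙 (𝟙_ T) = 0 := by
      have := hmul a a
      rwa [ha, h, Limits.comp_zero, Category.comp_id] at this
    have h2 : (1 : k) = 0 := hunit.1 (by simp [h1])
    exact one_ne_zero h2
  refine ⟨hmul, hne, fun a => ?_⟩
  obtain ⟨s, hs⟩ := hunit.2 (twistedTrace X (g X) (𝟙 X))
  obtain ⟨t, ht⟩ := hunit.2 (twistedTrace X (g X) a)
  simp only at hs ht
  have hs0 : s ≠ 0 := by
    rintro rfl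
    exact hne (by rw [← hs, zero_smul])
  refine ⟨t / s, ?_⟩
  by_contra hx
  have hx0 : a - (t / s) • 𝟙 X ≠ 0 := sub_ne_zero.2 hx
  have := isIso_of_hom_simple hx0
  have htr : twistedTrace X (g X) (a - (t / s) • 𝟙 X) = 0 := by
    rw [twistedTrace_sub, twistedTrace_smul, ← hs, ← ht, smul_smul, div_mul_cancel₀ _ hs0, sub_self]
  have h := hmul (a - (t / s) • 𝟙 X) (inv (a - (t / s) • 𝟙 X))
  rw [htr, Limits.zero_comp, IsIso.inv_hom_id, ← hs, Linear.smul_comp, Linear.comp_smul,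
    Category.comp_id, smul_smul, eq_comm] at h
  have h2 : s * s = 0 := hunit.1 (by simpa using h)
  exact hs0 (mul_self_eq_zero.1 h2)
end
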